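/- arXiv:0906.1560 — 2 statements merged into one kernel-verified Lean document; each statement's English description precedes it below -/
import Mathlib

section
/- Let ℓ_ij (1 ≤ i < j ≤ 4) be the edge lengths of a nondegenerate Euclidean tetrahedron and let d be a metric on it. Fix δ ∈ ℝ and consider the variation ℓ₁₂(t) = ℓ₁₂, ℓ₁₃(t) = ℓ₁₃, ℓ₂₃(t) = ℓ₂₃, ℓ₁₄(t) = ℓ₁₄ + t d₄₁ δ, ℓ₂₄(t) = ℓ₂₄ + t d₄₂ δ, ℓ₃₄(t) = ℓ₃₄ + t d₄₃ δ. Then at t = 0, d₄₁ (d/dt)β_{14,23} + d₄₂ (d/dt)β_{24,13} + d₄₃ (d/dt)β_{34,12} = −2 (A_{14,23}/ℓ₁₄ + A_{24,13}/ℓ₂₄ + A_{34,12}/ℓ₃₄) δ. -/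
/-- The angle at the vertex of a Euclidean triangle whose two adjacent sides have
lengths `a`, `b` and whose opposite side has length `c` (law of cosines). -/
noncomputable def triAngle (a b c : ℝ) : ℝ :=
  Real.arccos ((a ^ 2 + b ^ 2 - c ^ 2) / (2 * a * b))

/-- The dihedral angle `β_{ij,kl}` at the edge `{i,j}` of the tetrahedron `{i,j,k,l}`
with edge lengths `a = ℓ_ij`, `b = ℓ_ik`, `c = ℓ_il`, `p = ℓ_jk`, `q = ℓ_jl`,
`r = ℓ_kl`, via the spherical law of cosines:
`β_{ij,kl} = arccos((cos γ_{i,kl} − cos γ_{i,jk} cos γ_{i,jl})/(sin γ_{i,jk} sin γ_{i,jl}))`. -/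
noncomputable def dihedralAngle (a b c p q r : ℝ) : ℝ :=
  Real.arccos ((Real.cos (triAngle b c r)
      - Real.cos (triAngle a b p) * Real.cos (triAngle a c q)) /
    (Real.sin (triAngle a b p) * Real.sin (triAngle a c q)))

/-- `h_{ij,k} = (d_ik − d_ij cos γ_{i,jk})/sin γ_{i,jk}` as a function of `d_ik`,
`d_ij` and `γ = γ_{i,jk}`. -/
noncomputable def hFace (dik dij γ : ℝ) : ℝ := (dik - dij * Real.cos γ) / Real.sin γ

/-- `h_{ijk,l} = (h_{ij,l} − h_{ij,k} cos β_{ij,kl})/sin β_{ij,kl}` as a function of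
`h_{ij,l}`, `h_{ij,k}` and `β = β_{ij,kl}`. -/
noncomputable def hTet (hijl hijk β : ℝ) : ℝ := (hijl - hijk * Real.cos β) / Real.sin β

/-- The Cayley–Menger determinant of a tetrahedron with edge lengths
`a = ℓ₁₂`, `b = ℓ₁₃`, `c = ℓ₁₄`, `p = ℓ₂₃`, `q = ℓ₂₄`, `r = ℓ₃₄`. -/
noncomputable def cmDet (a b c p q r : ℝ) : ℝ :=
  Matrix.det !![(0 : ℝ), 1, 1, 1, 1;
    1, 0, a ^ 2, b ^ 2, c ^ 2;
    1, a ^ 2, 0, p ^ 2, q ^ 2;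
    1, b ^ 2, p ^ 2, 0, r ^ 2;
    1, c ^ 2, q ^ 2, r ^ 2, 0]

/-- Heron's formula for the area of a triangle with side lengths `a`, `b`, `c`. -/
noncomputable def heronArea (a b c : ℝ) : ℝ :=
  Real.sqrt ((a + b + c) * (-a + b + c) * (a - b + c) * (a + b - c)) / 4

/-- The inner product of two vectors of lengths `a`, `b` whose difference has length `c`. -/
noncomputable def edgeInner (a b c : ℝ) : ℝ := (a ^ 2 + b ^ 2 - c ^ 2) / 2

/-- The Gram determinant of two vectors of lengths `a`, `b` whose difference has length `c`;
four times the squared area of the triangle they span. -/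
noncomputable def edgeGram (a b c : ℝ) : ℝ := a ^ 2 * b ^ 2 - edgeInner a b c ^ 2

/-- The numerator of the cosine of `dihedralAngle a b c p q r`, in terms of the inner products
at the endpoint of `a` shared with `p` and `q`. -/
noncomputable def dihedralNum (a b c p q r : ℝ) : ℝ :=
  a ^ 2 * edgeInner p q r - edgeInner a p b * edgeInner a q c

lemma edgeInner_comm (a b c : ℝ) : edgeInner a b c = edgeInner b a c := by
  unfold edgeInner; ring

lemma edgeGram_comm (a b c : ℝ) : edgeGram a b c = edgeGram b a c := by
  unfold edgeGram edgeInner; ring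

lemma edgeGram_swap (a b c : ℝ) : edgeGram a b c = edgeGram a c b := by
  unfold edgeGram edgeInner; ring

lemma cmDet_eq (a b c p q r : ℝ) :
    cmDet a b c p q r = 8 * (c ^ 2 * q ^ 2 * r ^ 2
      + 2 * edgeInner c q a * edgeInner c r b * edgeInner q r p
      - c ^ 2 * edgeInner q r p ^ 2 - q ^ 2 * edgeInner c r b ^ 2
      - r ^ 2 * edgeInner c q a ^ 2) := by
  unfold cmDet edgeInner
  simp [Matrix.det_succ_row_zero, Fin.sum_univ_succ, Fin.succAbove]
  ring

lemma triAngle_arg (a b c : ℝ) :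
    (a ^ 2 + b ^ 2 - c ^ 2) / (2 * a * b) = edgeInner a b c / (a * b) := by
  unfold edgeInner; rw [div_div]; ring_nf

lemma one_sub_triAngle_arg_sq {a b : ℝ} (ha : 0 < a) (hb : 0 < b) (c : ℝ) :
    1 - (edgeInner a b c / (a * b)) ^ 2 = edgeGram a b c / (a * b) ^ 2 := by
  unfold edgeGram; field_simp

lemma sin_triAngle {a b : ℝ} (ha : 0 < a) (hb : 0 < b) (c : ℝ) :
    Real.sin (triAngle a b c) = √(edgeGram a b c) / (a * b) := by
  rw [triAngle, Real.sin_arccos, triAngle_arg, one_sub_triAngle_arg_sq ha hb,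
    Real.sqrt_div' _ (by positivity), Real.sqrt_sq (by positivity)]

lemma cos_triAngle {a b c : ℝ} (ha : 0 < a) (hb : 0 < b) (h : 0 ≤ edgeGram a b c) :
    Real.cos (triAngle a b c) = edgeInner a b c / (a * b) := by
  have h1 : (edgeInner a b c / (a * b)) ^ 2 ≤ 1 := by
    have := one_sub_triAngle_arg_sq ha hb c
    have : 0 ≤ edgeGram a b c / (a * b) ^ 2 := by positivity
    linarith
  rw [triAngle, triAngle_arg]
  exact Real.cos_arccos (abs_le.mp ((sq_le_one_iff_abs_le_one _).mp h1)).1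
    (abs_le.mp ((sq_le_one_iff_abs_le_one _).mp h1)).2

lemma sin_triAngle_of_neg {a b c : ℝ} (ha : 0 < a) (hb : 0 < b) (h : edgeGram a b c ≤ 0) :
    Real.sin (triAngle a b c) = 0 := by
  rw [sin_triAngle ha hb, Real.sqrt_eq_zero_of_nonpos h, zero_div]

lemma dihedralNum_eq (a b c p q r : ℝ) :
    dihedralNum a b c p q r
      = a ^ 2 * edgeInner b c r - edgeInner a b p * edgeInner a c q := by
  unfold dihedralNum edgeInner; ring

lemma dihedralAngle_eq {a b c p q r : ℝ} (ha : 0 < a) (hb : 0 < b) (hc : 0 < c)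
    (hP : 0 < edgeGram a p b) (hQ : 0 < edgeGram a q c) (hR : 0 ≤ edgeGram b c r) :
    dihedralAngle a b c p q r
      = Real.arccos (dihedralNum a b c p q r / (√(edgeGram a p b) * √(edgeGram a q c))) := by
  rw [edgeGram_swap a p b] at *
  rw [edgeGram_swap a q c] at *
  unfold dihedralAngle
  rw [cos_triAngle hb hc hR, cos_triAngle ha hb hP.le, cos_triAngle ha hc hQ.le,
    sin_triAngle ha hb, sin_triAngle ha hc, dihedralNum_eq]
  have := Real.sqrt_pos.mpr hP
  have := Real.sqrt_pos.mpr hQ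
  congr 1
  field_simp

lemma dihedral_sin_arg {a s P Q N : ℝ} (hP : 0 < P) (hQ : 0 < Q) (ha : 0 < a) (hs : 0 < s)
    (h : P * Q - N ^ 2 = a ^ 2 * s ^ 2) :
    √(1 - (N / (√P * √Q)) ^ 2) = a * s / (√P * √Q) := by
  have hp := Real.sqrt_pos.mpr hP
  have hq := Real.sqrt_pos.mpr hQ
  rw [Real.sqrt_eq_iff_mul_self_eq_of_pos (by positivity)]
  field_simp
  rw [Real.sq_sqrt hP.le, Real.sq_sqrt hQ.le]
  linarith

lemma dihedral_arg_sq_lt {a s P Q N : ℝ} (hP : 0 < P) (hQ : 0 < Q) (ha : 0 < a) (hs : 0 < s)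
    (h : P * Q - N ^ 2 = a ^ 2 * s ^ 2) : (N / (√P * √Q)) ^ 2 < 1 := by
  have hp := Real.sqrt_pos.mpr hP
  have hq := Real.sqrt_pos.mpr hQ
  rw [div_pow, mul_pow, Real.sq_sqrt hP.le, Real.sq_sqrt hQ.le, div_lt_one (by positivity)]
  have : 0 < a ^ 2 * s ^ 2 := by positivity
  linarith

lemma hasDerivAt_arccos_div_sqrt {P Q N : ℝ → ℝ} {P' Q' N' a s t : ℝ}
    (hP : HasDerivAt P P' t) (hQ : HasDerivAt Q Q' t) (hN : HasDerivAt N N' t)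
    (hP0 : 0 < P t) (hQ0 : 0 < Q t) (ha : 0 < a) (hs : 0 < s)
    (h : P t * Q t - N t ^ 2 = a ^ 2 * s ^ 2) :
    HasDerivAt (fun x => Real.arccos (N x / (√(P x) * √(Q x))))
      (-(N' - N t * (P' / (2 * P t) + Q' / (2 * Q t))) / (a * s)) t := by
  have hp := Real.sqrt_pos.mpr hP0
  have hq := Real.sqrt_pos.mpr hQ0
  have hlt := abs_lt.mp ((sq_lt_one_iff_abs_lt_one _).mp (dihedral_arg_sq_lt hP0 hQ0 ha hs h))
  have hd := hN.div ((hP.sqrt hP0.ne').mul (hQ.sqrt hQ0.ne')) (mul_pos hp hq).ne'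
  have hc := (Real.hasDerivAt_arccos hlt.1.ne' hlt.2.ne).comp t hd
  refine hc.congr_deriv ?_
  simp only [Pi.mul_apply]
  rw [dihedral_sin_arg hP0 hQ0 ha hs h]
  have hp2 := Real.sq_sqrt hP0.le
  have hq2 := Real.sq_sqrt hQ0.le
  generalize √(P t) = u at *
  generalize √(Q t) = v at *
  rw [← hp2, ← hq2]
  field_simp

lemma hasDerivAt_edgeInner {a b c : ℝ → ℝ} {a' b' c' t : ℝ} (ha : HasDerivAt a a' t)
    (hb : HasDerivAt b b' t) (hc : HasDerivAt c c' t) :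
    HasDerivAt (fun x => edgeInner (a x) (b x) (c x)) (a t * a' + b t * b' - c t * c') t := by
  unfold edgeInner
  refine ((((ha.pow 2).add (hb.pow 2)).sub (hc.pow 2)).div_const 2).congr_deriv ?_
  norm_num; ring

lemma hasDerivAt_edgeGram {a b : ℝ → ℝ} {a' b' t : ℝ} (c : ℝ) (ha : HasDerivAt a a' t)
    (hb : HasDerivAt b b' t) :
    HasDerivAt (fun x => edgeGram (a x) (b x) c)
      (2 * (a t * a' * b t ^ 2 + a t ^ 2 * (b t * b')
        - edgeInner (a t) (b t) c * (a t * a' + b t * b'))) t := by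
  unfold edgeGram
  refine (((ha.pow 2).mul (hb.pow 2)).sub
    ((hasDerivAt_edgeInner ha hb (hasDerivAt_const t c)).pow 2)).congr_deriv ?_
  norm_num; ring

/-- First variation of the dihedral angle at the edge `a` when the three edges at one of its
endpoints vary. -/
lemma hasDerivAt_dihedralAngle {a p q : ℝ → ℝ} {a' p' q' t b c r s : ℝ}
    (hda : HasDerivAt a a' t) (hdp : HasDerivAt p p' t) (hdq : HasDerivAt q q' t)
    (ha : 0 < a t) (hb : 0 < b) (hc : 0 < c) (hs : 0 < s)
    (hP : 0 < edgeGram (a t) (p t) b) (hQ : 0 < edgeGram (a t) (q t) c) (hR : 0 ≤ edgeGram b c r)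
    (h : edgeGram (a t) (p t) b * edgeGram (a t) (q t) c
      - dihedralNum (a t) b c (p t) (q t) r ^ 2 = a t ^ 2 * s ^ 2) :
    HasDerivAt (fun x => dihedralAngle (a x) b c (p x) (q x) r)
      (-(2 * (a t * a') * edgeInner (p t) (q t) r + a t ^ 2 * (p t * p' + q t * q')
          - (a t * a' + p t * p') * edgeInner (a t) (q t) c
          - edgeInner (a t) (p t) b * (a t * a' + q t * q')
          - dihedralNum (a t) b c (p t) (q t) r *
            ((a t * a' * p t ^ 2 + a t ^ 2 * (p t * p')
              - edgeInner (a t) (p t) b * (a t * a' + p t * p')) / edgeGram (a t) (p t) b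
            + (a t * a' * q t ^ 2 + a t ^ 2 * (q t * q')
              - edgeInner (a t) (q t) c * (a t * a' + q t * q')) / edgeGram (a t) (q t) c))
        / (a t * s)) t := by
  have dP := hasDerivAt_edgeGram b hda hdp
  have dQ := hasDerivAt_edgeGram c hda hdq
  have dN : HasDerivAt (fun x => dihedralNum (a x) b c (p x) (q x) r)
      (2 * (a t * a') * edgeInner (p t) (q t) r + a t ^ 2 * (p t * p' + q t * q')
          - (a t * a' + p t * p') * edgeInner (a t) (q t) c
          - edgeInner (a t) (p t) b * (a t * a' + q t * q')) t := by
    unfold dihedralNum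
    refine (((hda.pow 2).mul (hasDerivAt_edgeInner hdp hdq (hasDerivAt_const t r))).sub
      ((hasDerivAt_edgeInner hda hdp (hasDerivAt_const t b)).mul
        (hasDerivAt_edgeInner hda hdq (hasDerivAt_const t c)))).congr_deriv ?_
    norm_num; ring
  have hmain := hasDerivAt_arccos_div_sqrt dP dQ dN hP hQ ha hs h
  refine (hmain.congr_of_eventuallyEq ?_).congr_deriv ?_
  · filter_upwards [hda.continuousAt.eventually (lt_mem_nhds ha),
      dP.continuousAt.eventually (lt_mem_nhds hP),
      dQ.continuousAt.eventually (lt_mem_nhds hQ)] with x h1 h2 h3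
    exact dihedralAngle_eq h1 hb hc h2 h3 hR
  · rw [mul_div_mul_left _ _ two_ne_zero, mul_div_mul_left _ _ two_ne_zero]

lemma dihedralAngle_of_neg {a b c p q r : ℝ} (ha : 0 < a) (hb : 0 < b)
    (hP : edgeGram a p b ≤ 0) : dihedralAngle a b c p q r = Real.pi / 2 := by
  rw [edgeGram_swap] at hP
  rw [dihedralAngle, sin_triAngle_of_neg ha hb hP, zero_mul, div_zero, Real.arccos_zero]

lemma deriv_dihedralAngle_of_neg {a p q : ℝ → ℝ} {t b c r : ℝ} (ca : ContinuousAt a t)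
    (cp : ContinuousAt p t) (ha : 0 < a t) (hb : 0 < b) (hP : edgeGram (a t) (p t) b < 0) :
    deriv (fun x => dihedralAngle (a x) b c (p x) (q x) r) t = 0 := by
  have hc : ContinuousAt (fun x => edgeGram (a x) (p x) b) t := by
    unfold edgeGram edgeInner; fun_prop
  have : (fun x => dihedralAngle (a x) b c (p x) (q x) r) =ᶠ[nhds t] fun _ => Real.pi / 2 := by
    filter_upwards [ca.eventually (lt_mem_nhds ha), hc.eventually (gt_mem_nhds hP)] with x h1 h2
    exact dihedralAngle_of_neg h1 hb h2.le
  rw [this.deriv_eq, deriv_const]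

lemma hFace_of_neg {a b c : ℝ} (x y : ℝ) (ha : 0 < a) (hb : 0 < b) (h : edgeGram a b c ≤ 0) :
    hFace x y (triAngle a b c) = 0 := by
  rw [hFace, sin_triAngle_of_neg ha hb h, div_zero]

lemma hFace_eq {a b p d₁ d₂ m n : ℝ} (ha : 0 < a) (hb : 0 < b) (hP : 0 < edgeGram a p b)
    (h₁ : a * d₁ = a ^ 2 - m) (h₂ : b * d₂ = a ^ 2 - edgeInner a p b + n - m) :
    hFace d₂ d₁ (triAngle a b p)
      = (a ^ 2 * n - m * edgeInner a p b) / (a * √(edgeGram a p b)) := by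
  have hp := Real.sqrt_pos.mpr hP
  rw [edgeGram_swap] at hP
  rw [hFace, cos_triAngle ha hb hP.le, sin_triAngle ha hb, edgeGram_swap a b p]
  have hX : edgeInner a b p = a ^ 2 - edgeInner a p b := by unfold edgeInner; ring
  rw [hX, div_eq_div_iff (by positivity) (by positivity)]
  field_simp
  linear_combination (-(a^2 - edgeInner a p b)) * h₁ + a ^ 2 * h₂

/-- The symmetrised product `A` at an edge, in closed form. -/
lemma hFace_mul_hTet_eq {a b c p q r d₁ d₂ d₃ m n k s : ℝ} (ha : 0 < a) (hb : 0 < b) (hc : 0 < c)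
    (hs : 0 < s)
    (hP : 0 < edgeGram a p b) (hQ : 0 < edgeGram a q c) (hR : 0 ≤ edgeGram b c r)
    (h : edgeGram a p b * edgeGram a q c - dihedralNum a b c p q r ^ 2 = a ^ 2 * s ^ 2)
    (h₁ : a * d₁ = a ^ 2 - m) (h₂ : b * d₂ = a ^ 2 - edgeInner a p b + n - m)
    (h₃ : c * d₃ = a ^ 2 - edgeInner a q c + k - m) :
    1 / 2 * (hFace d₂ d₁ (triAngle a b p) *
        hTet (hFace d₃ d₁ (triAngle a c q)) (hFace d₂ d₁ (triAngle a b p))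
          (dihedralAngle a b c p q r)
      + hFace d₃ d₁ (triAngle a c q) *
        hTet (hFace d₂ d₁ (triAngle a b p)) (hFace d₃ d₁ (triAngle a c q))
          (dihedralAngle a b c p q r)) / a
      = (2 * (a ^ 2 * n - m * edgeInner a p b) * (a ^ 2 * k - m * edgeInner a q c)
          - ((a ^ 2 * n - m * edgeInner a p b) ^ 2 / edgeGram a p b
            + (a ^ 2 * k - m * edgeInner a q c) ^ 2 / edgeGram a q c)
              * dihedralNum a b c p q r) / (2 * (a ^ 2) ^ 2 * s) := by
  have hp := Real.sqrt_pos.mpr hP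
  have hq := Real.sqrt_pos.mpr hQ
  have hle := abs_lt.mp ((sq_lt_one_iff_abs_lt_one _).mp (dihedral_arg_sq_lt hP hQ ha hs h))
  rw [hFace_eq ha hb hP h₁ h₂, hFace_eq ha hc hQ h₁ h₃, dihedralAngle_eq ha hb hc hP hQ hR]
  unfold hTet
  rw [Real.cos_arccos hle.1.le hle.2.le, Real.sin_arccos, dihedral_sin_arg hP hQ ha hs h]
  have hp2 := Real.sq_sqrt hP.le
  have hq2 := Real.sq_sqrt hQ.le
  generalize √(edgeGram a p b) = u at *
  generalize √(edgeGram a q c) = v at *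
  rw [← hp2, ← hq2]
  field_simp
  ring

/-- The terms of the variation formula that have the Gram determinant of one face in the
denominator. -/
lemma face_terms {A B g x y m n P N M : ℝ} (hA : A ≠ 0) (hB : B ≠ 0) (hP0 : P ≠ 0)
    (hP : P = A * B - g ^ 2) (hN : N = A * y - g * x) (hM : M = B * x - g * y) :
    (A * n - m * g) ^ 2 / P * N / A ^ 2 + (B * m - n * g) ^ 2 / P * M / B ^ 2
      - (m * N / A + n * M / B) * ((m * B + A * n - g * (m + n)) / P)
      = (n - m) * (n * y / B - m * x / A) - m ^ 2 * N / A ^ 2 - n ^ 2 * M / B ^ 2 := by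
  subst hN hM
  have hB' : B = (P + g ^ 2) / A := by rw [hP]; field_simp; ring
  have : P + g ^ 2 ≠ 0 := by rw [hP]; ring_nf; exact mul_ne_zero hA hB
  subst hB'
  field_simp
  ring

/-- The polynomial identity behind the variation formula, in terms of the Gram matrix
`(A, B, C; g, h, k)` of the edges at a vertex and the inner products `m, n, o` of these edges
with the position vector of the centre. -/
lemma gram_variation_identity {A B C g h k m n o P Q R L M N : ℝ}
    (hA : A ≠ 0) (hB : B ≠ 0) (hC : C ≠ 0) (hP0 : P ≠ 0) (hQ0 : Q ≠ 0) (hR0 : R ≠ 0)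
    (hP : P = A * B - g ^ 2) (hQ : Q = A * C - h ^ 2) (hR : R = B * C - k ^ 2)
    (hL : L = A * k - g * h) (hM : M = B * h - g * k) (hN : N = C * g - h * k) :
    m / A * (2 * m * k + A * (n + o) - (m + n) * h - g * (m + o)
        - L * ((m * B + A * n - g * (m + n)) / P + (m * C + A * o - h * (m + o)) / Q))
      + n / B * (2 * n * h + B * (m + o) - (n + m) * k - g * (n + o)
        - M * ((n * A + B * m - g * (n + m)) / P + (n * C + B * o - k * (n + o)) / R))
      + o / C * (2 * o * g + C * (m + n) - (o + m) * k - h * (o + n)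
        - N * ((o * A + C * m - h * (o + m)) / Q + (o * B + C * n - k * (o + n)) / R))
      = (2 * (A * n - m * g) * (A * o - m * h)
          - ((A * n - m * g) ^ 2 / P + (A * o - m * h) ^ 2 / Q) * L) / A ^ 2
      + (2 * (B * m - n * g) * (B * o - n * k)
          - ((B * m - n * g) ^ 2 / P + (B * o - n * k) ^ 2 / R) * M) / B ^ 2
      + (2 * (C * m - o * h) * (C * n - o * k)
          - ((C * m - o * h) ^ 2 / Q + (C * n - o * k) ^ 2 / R) * N) / C ^ 2 := by
  have e1 := face_terms (m := m) (n := n) hA hB hP0 hP hL (hM.trans (by ring))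
  have e2 := face_terms (m := m) (n := o) hA hC hQ0 hQ (hL.trans (by ring) : L = A * k - h * g)
    (hN.trans (by ring))
  have e3 := face_terms (m := n) (n := o) hB hC hR0 hR (hM.trans (by ring) : M = B * h - k * g)
    (hN.trans (by ring))
  have e4 : m / A * (2 * m * k + A * (n + o) - (m + n) * h - g * (m + o))
      + n / B * (2 * n * h + B * (m + o) - (n + m) * k - g * (n + o))
      + o / C * (2 * o * g + C * (m + n) - (o + m) * k - h * (o + n))
      + ((n - m) * (n * k / B - m * h / A) - m ^ 2 * L / A ^ 2 - n ^ 2 * M / B ^ 2)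
      + ((o - m) * (o * k / C - m * g / A) - m ^ 2 * L / A ^ 2 - o ^ 2 * N / C ^ 2)
      + ((o - n) * (o * h / C - n * g / B) - n ^ 2 * M / B ^ 2 - o ^ 2 * N / C ^ 2)
      = 2 * (A * n - m * g) * (A * o - m * h) / A ^ 2
        + 2 * (B * m - n * g) * (B * o - n * k) / B ^ 2
        + 2 * (C * m - o * h) * (C * n - o * k) / C ^ 2 := by
    subst hL hM hN
    field_simp
    ring
  linear_combination e4 + e1 + e2 + e3

lemma edgeGram_mul_edgeGram (a b c p q r : ℝ) :
    edgeGram a p b * edgeGram a q c - dihedralNum a b c p q r ^ 2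
      = a ^ 2 * (cmDet b c a r p q / 8) := by
  rw [cmDet_eq, dihedralNum]
  unfold edgeGram edgeInner
  ring

lemma mul_pos_of_mul_sub_sq {P Q N a D : ℝ} (ha : 0 < a) (hD : 0 < D)
    (h : P * Q - N ^ 2 = a ^ 2 * D) : 0 < P * Q := by
  have : 0 < a ^ 2 * D := by positivity
  linarith [sq_nonneg N]

/-- For a nondegenerate tetrahedron with a metric `d`, under the variation
`ℓ₁₄(t) = ℓ₁₄ + t d₄₁ δ`, `ℓ₂₄(t) = ℓ₂₄ + t d₄₂ δ`, `ℓ₃₄(t) = ℓ₃₄ + t d₄₃ δ`,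
at `t = 0`:
`d₄₁ β₁₄′ + d₄₂ β₂₄′ + d₄₃ β₃₄′ = −2 (A_{14,23}/ℓ₁₄ + A_{24,13}/ℓ₂₄ + A_{34,12}/ℓ₃₄) δ`. -/
theorem weighted_dihedral_variation_vertex4
    (l12 l13 l14 l23 l24 l34 : ℝ)
    (hp12 : 0 < l12) (hp13 : 0 < l13) (hp14 : 0 < l14)
    (hp23 : 0 < l23) (hp24 : 0 < l24) (hp34 : 0 < l34)
    (hnd : 0 < cmDet l12 l13 l14 l23 l24 l34)
    (d12 d21 d13 d31 d14 d41 d23 d32 d24 d42 d34 d43 : ℝ)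
    (hs12 : d12 + d21 = l12) (hs13 : d13 + d31 = l13) (hs14 : d14 + d41 = l14)
    (hs23 : d23 + d32 = l23) (hs24 : d24 + d42 = l24) (hs34 : d34 + d43 = l34)
    (hm123 : d12 ^ 2 + d23 ^ 2 + d31 ^ 2 = d21 ^ 2 + d32 ^ 2 + d13 ^ 2)
    (hm124 : d12 ^ 2 + d24 ^ 2 + d41 ^ 2 = d21 ^ 2 + d42 ^ 2 + d14 ^ 2)
    (hm134 : d13 ^ 2 + d34 ^ 2 + d41 ^ 2 = d31 ^ 2 + d43 ^ 2 + d14 ^ 2)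
    (hm234 : d23 ^ 2 + d34 ^ 2 + d42 ^ 2 = d32 ^ 2 + d43 ^ 2 + d24 ^ 2)
    (δ : ℝ) :
    -- A_{14,23}
    let h142 := hFace d12 d14 (triAngle l14 l12 l24)      -- h_{14,2}
    let h143 := hFace d13 d14 (triAngle l14 l13 l34)      -- h_{14,3}
    let β1423 := dihedralAngle l14 l12 l13 l24 l34 l23    -- β_{14,23}
    let A1423 := (1 / 2) * (h142 * hTet h143 h142 β1423 + h143 * hTet h142 h143 β1423)
    -- A_{24,13}
    let h241 := hFace d21 d24 (triAngle l24 l12 l14)      -- h_{24,1}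
    let h243 := hFace d23 d24 (triAngle l24 l23 l34)      -- h_{24,3}
    let β2413 := dihedralAngle l24 l12 l23 l14 l34 l13    -- β_{24,13}
    let A2413 := (1 / 2) * (h241 * hTet h243 h241 β2413 + h243 * hTet h241 h243 β2413)
    -- A_{34,12}
    let h341 := hFace d31 d34 (triAngle l34 l13 l14)      -- h_{34,1}
    let h342 := hFace d32 d34 (triAngle l34 l23 l24)      -- h_{34,2}
    let β3412 := dihedralAngle l34 l13 l23 l14 l24 l12    -- β_{34,12}
    let A3412 := (1 / 2) * (h341 * hTet h342 h341 β3412 + h342 * hTet h341 h342 β3412)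
    d41 * deriv (fun t : ℝ => dihedralAngle (l14 + t * (d41 * δ)) l12 l13
        (l24 + t * (d42 * δ)) (l34 + t * (d43 * δ)) l23) 0
      + d42 * deriv (fun t : ℝ => dihedralAngle (l24 + t * (d42 * δ)) l12 l23
        (l14 + t * (d41 * δ)) (l34 + t * (d43 * δ)) l13) 0
      + d43 * deriv (fun t : ℝ => dihedralAngle (l34 + t * (d43 * δ)) l13 l23
        (l14 + t * (d41 * δ)) (l24 + t * (d42 * δ)) l12) 0
      = -2 * (A1423 / l14 + A2413 / l24 + A3412 / l34) * δ := by
  have hG : 0 < cmDet l12 l13 l14 l23 l24 l34 / 8 := by positivity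
  have e1 := edgeGram_mul_edgeGram l14 l12 l13 l24 l34 l23
  have e2 := edgeGram_mul_edgeGram l24 l12 l23 l14 l34 l13
  have e3 := edgeGram_mul_edgeGram l34 l13 l23 l14 l24 l12
  have e4 := edgeGram_mul_edgeGram l12 l24 l23 l14 l13 l34
  rw [show cmDet l12 l23 l24 l13 l14 l34 = cmDet l12 l13 l14 l23 l24 l34 by
    simp only [cmDet_eq, edgeInner]; ring, edgeGram_comm l24 l14 l12] at e2
  rw [show cmDet l13 l23 l34 l12 l14 l24 = cmDet l12 l13 l14 l23 l24 l34 by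
    simp only [cmDet_eq, edgeInner]; ring, edgeGram_comm l34 l14, edgeGram_comm l34 l24] at e3
  rw [show cmDet l24 l23 l12 l34 l14 l13 = cmDet l12 l13 l14 l23 l24 l34 by
    simp only [cmDet_eq, edgeInner]; ring,
    show edgeGram l12 l14 l24 = edgeGram l14 l24 l12 by unfold edgeGram edgeInner; ring] at e4
  have hPQ : 0 < edgeGram l14 l24 l12 * edgeGram l14 l34 l13 :=
    mul_pos_of_mul_sub_sq hp14 hG e1
  have hPR : 0 < edgeGram l14 l24 l12 * edgeGram l24 l34 l23 :=
    mul_pos_of_mul_sub_sq hp24 hG e2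
  have hPT : 0 < edgeGram l14 l24 l12 * edgeGram l12 l13 l23 :=
    mul_pos_of_mul_sub_sq hp12 hG e4
  have hlin (l c : ℝ) : HasDerivAt (fun t : ℝ => l + t * c) c 0 := by
    simpa using ((hasDerivAt_id (0 : ℝ)).mul_const c).const_add l
  intro h142 h143 β1423 A1423 h241 h243 β2413 A2413 h341 h342 β3412 A3412
  rcases lt_or_ge 0 (edgeGram l14 l24 l12) with hP | hP
  · have hQ := pos_of_mul_pos_right hPQ hP.le
    have hR := pos_of_mul_pos_right hPR hP.le
    have hT := (pos_of_mul_pos_right hPT hP.le).le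
    obtain ⟨s, hs, hsq⟩ : ∃ s : ℝ, 0 < s ∧ cmDet l12 l13 l14 l23 l24 l34 / 8 = s ^ 2 :=
      ⟨_, Real.sqrt_pos.mpr hG, (Real.sq_sqrt hG.le).symm⟩
    rw [hsq] at e1 e2 e3
    have hP' := hP
    have hQ' := hQ
    have hR' := hR
    rw [edgeGram_comm] at hP' hQ' hR'
    have hT2 : 0 ≤ edgeGram l12 l23 l13 := edgeGram_swap l12 l13 l23 ▸ hT
    have hT3 : 0 ≤ edgeGram l13 l23 l12 := by rwa [edgeGram_swap, edgeGram_comm]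
    have D1 := (hasDerivAt_dihedralAngle (hlin l14 (d41 * δ)) (hlin l24 (d42 * δ))
      (hlin l34 (d43 * δ)) (b := l12) (c := l13) (r := l23) (s := s)
      (by simpa) hp12 hp13 hs (by simpa) (by simpa) hT (by simpa using e1)).deriv
    have D2 := (hasDerivAt_dihedralAngle (hlin l24 (d42 * δ)) (hlin l14 (d41 * δ))
      (hlin l34 (d43 * δ)) (b := l12) (c := l23) (r := l13) (s := s)
      (by simpa) hp12 hp23 hs (by simpa) (by simpa) hT2
      (by simpa [edgeGram_comm l24 l14] using e2)).deriv
    have D3 := (hasDerivAt_dihedralAngle (hlin l34 (d43 * δ)) (hlin l14 (d41 * δ))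
      (hlin l24 (d42 * δ)) (b := l13) (c := l23) (r := l12) (s := s)
      (by simpa) hp13 hp23 hs (by simpa) (by simpa) hT3
      (by simpa [edgeGram_comm l34 l14, edgeGram_comm l34 l24] using e3)).deriv
    have F1 : A1423 / l14 = _ :=
      hFace_mul_hTet_eq (m := l14 * d41) (n := l24 * d42) (k := l34 * d43)
        hp14 hp12 hp13 hs hP hQ hT e1 (by rw [← hs14]; ring)
        (by subst_vars; unfold edgeInner; linear_combination hm124 / 2)
        (by subst_vars; unfold edgeInner; linear_combination hm134 / 2)
    have F2 : A2413 / l24 = _ :=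
      hFace_mul_hTet_eq (m := l24 * d42) (n := l14 * d41) (k := l34 * d43)
        hp24 hp12 hp23 hs hP' hR hT2 (by simpa [edgeGram_comm l24 l14] using e2)
        (by rw [← hs24]; ring)
        (by subst_vars; unfold edgeInner; linear_combination -hm124 / 2)
        (by subst_vars; unfold edgeInner; linear_combination hm234 / 2)
    have F3 : A3412 / l34 = _ :=
      hFace_mul_hTet_eq (m := l34 * d43) (n := l14 * d41) (k := l24 * d42)
        hp34 hp13 hp23 hs hQ' hR' hT3
        (by simpa [edgeGram_comm l34 l14, edgeGram_comm l34 l24] using e3)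
        (by rw [← hs34]; ring)
        (by subst_vars; unfold edgeInner; linear_combination -hm134 / 2)
        (by subst_vars; unfold edgeInner; linear_combination -hm234 / 2)
    rw [D1, D2, D3, F1, F2, F3]
    have key := gram_variation_identity (A := l14 ^ 2) (B := l24 ^ 2) (C := l34 ^ 2)
      (g := edgeInner l14 l24 l12) (h := edgeInner l14 l34 l13) (k := edgeInner l24 l34 l23)
      (m := l14 * d41) (n := l24 * d42) (o := l34 * d43)
      (L := dihedralNum l14 l12 l13 l24 l34 l23) (M := dihedralNum l24 l12 l23 l14 l34 l13)
      (N := dihedralNum l34 l13 l23 l14 l24 l12)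
      (by positivity) (by positivity) (by positivity) hP.ne' hQ.ne' hR.ne' rfl rfl rfl rfl
      (by rw [dihedralNum, edgeInner_comm l24 l14])
      (by rw [dihedralNum, edgeInner_comm l34 l14, edgeInner_comm l34 l24])
    simp only [zero_mul, add_zero, edgeGram_comm l24 l14, edgeGram_comm l34 l14,
      edgeGram_comm l34 l24, edgeInner_comm l24 l14, edgeInner_comm l34 l14,
      edgeInner_comm l34 l24]
    have r (l d x : ℝ) (hl : 0 < l) : d * (-x / (l * s)) = -(l * d / l ^ 2 * x) / s := by
      field_simp
    rw [r _ _ _ hp14, r _ _ _ hp24, r _ _ _ hp34]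
    linear_combination (-(δ / s)) * key
  · have hP0 : edgeGram l14 l24 l12 < 0 := lt_of_le_of_ne hP fun h => by simp [h] at hPQ
    have hQ0 : edgeGram l14 l34 l13 < 0 := neg_of_mul_pos_right hPQ hP
    have hR0 : edgeGram l24 l34 l23 < 0 := neg_of_mul_pos_right hPR hP
    have z1 : h142 = 0 := hFace_of_neg _ _ hp14 hp12 (by rw [edgeGram_swap]; exact hP)
    have z2 : h143 = 0 := hFace_of_neg _ _ hp14 hp13 (by rw [edgeGram_swap]; exact hQ0.le)
    have z3 : h241 = 0 :=
      hFace_of_neg _ _ hp24 hp12 (by rw [edgeGram_swap, edgeGram_comm]; exact hP)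
    have z4 : h243 = 0 := hFace_of_neg _ _ hp24 hp23 (by rw [edgeGram_swap]; exact hR0.le)
    have z5 : h341 = 0 :=
      hFace_of_neg _ _ hp34 hp13 (by rw [edgeGram_swap, edgeGram_comm]; exact hQ0.le)
    have z6 : h342 = 0 :=
      hFace_of_neg _ _ hp34 hp23 (by rw [edgeGram_swap, edgeGram_comm]; exact hR0.le)
    rw [deriv_dihedralAngle_of_neg (hlin _ _).continuousAt (hlin _ _).continuousAt (by simpa) hp12
        (by simpa),
      deriv_dihedralAngle_of_neg (hlin _ _).continuousAt (hlin _ _).continuousAt (by simpa) hp12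
        (by simpa [edgeGram_comm l24 l14]),
      deriv_dihedralAngle_of_neg (hlin _ _).continuousAt (hlin _ _).continuousAt (by simpa) hp13
        (by simpa [edgeGram_comm l34 l14])]
    simp [A1423, A2413, A3412, z1, z2, z3, z4, z5, z6]
end

section
/- Given a three-dimensional conformal structure on U ⊆ ℝ^V for a tetrahedron collection 𝒯, let f : (−ε, ε) → U be a smooth curve. Then for every vertex i, at t = 0, (d/dt) K_i(f(t)) = −Σ_{j : {i,j} an edge} (2 ℓ*_ij/ℓ_ij − (q_ij/ℓ_ij) K_ij)(f_j′ − f_i′) + K_i f_i′. -/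
open Finset

/-- `{i, j}` is an edge of the tetrahedron collection `𝒯`. -/
def IsEdge {V : Type*} [DecidableEq V] (𝒯 : Finset (Finset V)) (i j : V) : Prop :=
  i ≠ j ∧ ∃ T ∈ 𝒯, i ∈ T ∧ j ∈ T

instance {V : Type*} [DecidableEq V] (𝒯 : Finset (Finset V)) (i j : V) :
    Decidable (IsEdge 𝒯 i j) := by
  unfold IsEdge; infer_instance

/-- A three-dimensional conformal structure on an open set `U ⊆ ℝ^V` for a collection
`𝒯` of tetrahedra: a smooth assignment `f ↦ d f i j` of reals to ordered edges, where
`d f i j` depends only on `f i` and `f j`, the induced lengths `ℓ_ij = d_ij + d_ji` are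
positive and make every member of `𝒯` a nondegenerate Euclidean tetrahedron, the metric
condition holds on every triangular face, and `∂ℓ_ij/∂f_i = d_ij`. -/
structure Conformal3D (V : Type*) [Fintype V] [DecidableEq V]
    (𝒯 : Finset (Finset V)) (U : Set (V → ℝ)) where
  d : (V → ℝ) → V → V → ℝ
  openU : IsOpen U
  card4 : ∀ T ∈ 𝒯, T.card = 4
  smooth : ∀ i j, IsEdge 𝒯 i j → ContDiffOn ℝ (⊤ : ℕ∞) (fun f => d f i j) U
  localDep : ∀ i j, IsEdge 𝒯 i j → ∀ f g : V → ℝ, f i = g i → f j = g j →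
    d f i j = d g i j
  lenPos : ∀ f ∈ U, ∀ i j, IsEdge 𝒯 i j → 0 < d f i j + d f j i
  nondeg : ∀ f ∈ U, ∀ T ∈ 𝒯, ∀ i ∈ T, ∀ j ∈ T, ∀ k ∈ T, ∀ l ∈ T,
    i ≠ j → i ≠ k → i ≠ l → j ≠ k → j ≠ l → k ≠ l →
    0 < cmDet (d f i j + d f j i) (d f i k + d f k i) (d f i l + d f l i)
      (d f j k + d f k j) (d f j l + d f l j) (d f k l + d f l k)
  metricCond : ∀ f ∈ U, ∀ T ∈ 𝒯, ∀ i ∈ T, ∀ j ∈ T, ∀ k ∈ T, i ≠ j → i ≠ k → j ≠ k →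
    d f i j ^ 2 + d f j k ^ 2 + d f k i ^ 2 = d f j i ^ 2 + d f k j ^ 2 + d f i k ^ 2
  derivLen : ∀ i j, IsEdge 𝒯 i j → ∀ f ∈ U,
    HasDerivAt (fun s : ℝ =>
        d (Function.update f i s) i j + d (Function.update f i s) j i)
      (d f i j) (f i)

namespace Conformal3D

variable {V : Type*} [Fintype V] [DecidableEq V] {𝒯 : Finset (Finset V)}
  {U : Set (V → ℝ)}

/-- The length `ℓ_ij = d_ij + d_ji`. -/
noncomputable def len (C : Conformal3D V 𝒯 U) (f : V → ℝ) (i j : V) : ℝ :=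
  C.d f i j + C.d f j i

/-- The face angle `γ_{i,jk}` at vertex `i` in the triangle `{i, j, k}`. -/
noncomputable def fang (C : Conformal3D V 𝒯 U) (f : V → ℝ) (i j k : V) : ℝ :=
  triAngle (C.len f i j) (C.len f i k) (C.len f j k)

/-- `h_{ij,k} = (d_ik − d_ij cos γ_{i,jk}) / sin γ_{i,jk}`. -/
noncomputable def hf (C : Conformal3D V 𝒯 U) (f : V → ℝ) (i j k : V) : ℝ :=
  (C.d f i k - C.d f i j * Real.cos (C.fang f i j k)) / Real.sin (C.fang f i j k)

/-- The dihedral angle `β_{ij,kl}` at edge `{i,j}` in the tetrahedron `{i,j,k,l}`. -/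
noncomputable def beta (C : Conformal3D V 𝒯 U) (f : V → ℝ) (i j k l : V) : ℝ :=
  dihedralAngle (C.len f i j) (C.len f i k) (C.len f i l)
    (C.len f j k) (C.len f j l) (C.len f k l)

/-- `h_{ijk,l} = (h_{ij,l} − h_{ij,k} cos β_{ij,kl}) / sin β_{ij,kl}`. -/
noncomputable def ht (C : Conformal3D V 𝒯 U) (f : V → ℝ) (i j k l : V) : ℝ :=
  (C.hf f i j l - C.hf f i j k * Real.cos (C.beta f i j k l)) /
    Real.sin (C.beta f i j k l)

/-- The dual area `A_{ij,kl} = ½(h_{ij,k} h_{ijk,l} + h_{ij,l} h_{ijl,k})`. -/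
noncomputable def Aq (C : Conformal3D V 𝒯 U) (f : V → ℝ) (i j k l : V) : ℝ :=
  (1 / 2) * (C.hf f i j k * C.ht f i j k l + C.hf f i j l * C.ht f i j l k)

/-- The dual length (area) `ℓ*_ij = Σ_{{i,j,k,l} ∈ 𝒯} A_{ij,kl}` (each unordered
tetrahedron containing `{i,j}` counted once; the ordered double sum over `k, l`
counts it twice, whence `1/2`). -/
noncomputable def dualLen (C : Conformal3D V 𝒯 U) (f : V → ℝ) (i j : V) : ℝ :=
  (1 / 2) * ∑ k : V, ∑ l : V,
    if ({i, j, k, l} : Finset V) ∈ 𝒯 ∧ i ≠ j ∧ i ≠ k ∧ i ≠ l ∧ j ≠ k ∧ j ≠ l ∧ k ≠ l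
    then C.Aq f i j k l else 0

/-- The sum `Σ_{{i,j,k,l} ∈ 𝒯} β_{ij,kl}` of dihedral angles around the edge `{i,j}`. -/
noncomputable def angSum (C : Conformal3D V 𝒯 U) (f : V → ℝ) (i j : V) : ℝ :=
  (1 / 2) * ∑ k : V, ∑ l : V,
    if ({i, j, k, l} : Finset V) ∈ 𝒯 ∧ i ≠ j ∧ i ≠ k ∧ i ≠ l ∧ j ≠ k ∧ j ≠ l ∧ k ≠ l
    then C.beta f i j k l else 0

/-- The edge curvature `K_ij = (2π − Σ_{{i,j,k,l} ∈ 𝒯} β_{ij,kl}) ℓ_ij`. -/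
noncomputable def Kedge (C : Conformal3D V 𝒯 U) (f : V → ℝ) (i j : V) : ℝ :=
  (2 * Real.pi - C.angSum f i j) * C.len f i j

/-- The scalar curvature `K_i = Σ_{j : {i,j} edge} (2π − Σ β_{ij,kl}) d_ij`. -/
noncomputable def Kv (C : Conformal3D V 𝒯 U) (f : V → ℝ) (i : V) : ℝ :=
  ∑ j : V, if IsEdge 𝒯 i j then (2 * Real.pi - C.angSum f i j) * C.d f i j else 0

/-- `q_ij = ∂d_ij/∂f_j`. -/
noncomputable def qq (C : Conformal3D V 𝒯 U) (f : V → ℝ) (i j : V) : ℝ :=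
  deriv (fun s : ℝ => C.d (Function.update f j s) i j) (f j)

/-- The Einstein–Hilbert–Regge functional `EHR = Σ_{edges {i,j}} K_ij`
(ordered double sum halved). -/
noncomputable def EHR (C : Conformal3D V 𝒯 U) (f : V → ℝ) : ℝ :=
  (1 / 2) * ∑ i : V, ∑ j : V, if IsEdge 𝒯 i j then C.Kedge f i j else 0

end Conformal3D

theorem sum_sum_sum_eq_zero_of_cyclic {ι : Type*} [Fintype ι] {G : ι → ι → ι → ℝ}
    (hG : ∀ j k l, G j k l + G k l j + G l j k = 0) : ∑ j, ∑ k, ∑ l, G j k l = 0 := by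
  have h1 : ∑ j, ∑ k, ∑ l, G k l j = ∑ j, ∑ k, ∑ l, G j k l := by
    rw [Finset.sum_comm]
    exact Finset.sum_congr rfl fun _ _ => Finset.sum_comm
  have h2 : ∑ j, ∑ k, ∑ l, G l j k = ∑ j, ∑ k, ∑ l, G j k l :=
    (Finset.sum_congr rfl fun _ _ => Finset.sum_comm).trans Finset.sum_comm
  have h3 : ∑ j, ∑ k, ∑ l, (G j k l + G k l j + G l j k) = 0 := by simp [hG]
  simp only [Finset.sum_add_distrib] at h3
  linarith

namespace Conformal3D

theorem gram_cyclic_identity (A B C x y z sj sk sl fi fj fk fl : ℝ)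
    (hA : A ≠ 0) (hB : B ≠ 0) (hC : C ≠ 0)
    (hP : A * B - x ^ 2 ≠ 0) (hQ : A * C - y ^ 2 ≠ 0) (hR : B * C - z ^ 2 ≠ 0)
    (dA dB dC dx dy dz : ℝ)
    (hdA : dA = 2 * (sj * fi + (A - sj) * fj)) (hdB : dB = 2 * (sk * fi + (B - sk) * fk))
    (hdC : dC = 2 * (sl * fi + (C - sl) * fl))
    (hdx : dx = (sj + sk) * fi + (x - sk) * fj + (x - sj) * fk)
    (hdy : dy = (sj + sl) * fi + (y - sl) * fj + (y - sj) * fl)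
    (hdz : dz = (sk + sl) * fi + (z - sl) * fk + (z - sk) * fl) :
    sj / A * ((dA * z + A * dz - dx * y - x * dy) - (A * z - x * y) *
        ((dA * B + A * dB - 2 * x * dx) / (A * B - x ^ 2) +
          (dA * C + A * dC - 2 * y * dy) / (A * C - y ^ 2)) / 2)
    + sk / B * ((dB * y + B * dy - dz * x - z * dx) - (B * y - z * x) *
        ((dB * C + B * dC - 2 * z * dz) / (B * C - z ^ 2) +
          (dB * A + B * dA - 2 * x * dx) / (A * B - x ^ 2)) / 2)
    + sl / C * ((dC * x + C * dx - dy * z - y * dz) - (C * x - y * z) *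
        ((dC * A + C * dA - 2 * y * dy) / (A * C - y ^ 2) +
          (dC * B + C * dB - 2 * z * dz) / (B * C - z ^ 2)) / 2)
    = -((2 * (A * sk - sj * x) * (A * sl - sj * y) - (A * z - x * y) *
          ((A * sk - sj * x) ^ 2 / (A * B - x ^ 2) + (A * sl - sj * y) ^ 2 / (A * C - y ^ 2)))
          / A ^ 2 * (fj - fi)
      + (2 * (B * sl - sk * z) * (B * sj - sk * x) - (B * y - z * x) *
          ((B * sl - sk * z) ^ 2 / (B * C - z ^ 2) + (B * sj - sk * x) ^ 2 / (A * B - x ^ 2)))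
          / B ^ 2 * (fk - fi)
      + (2 * (C * sj - sl * y) * (C * sk - sl * z) - (C * x - y * z) *
          ((C * sj - sl * y) ^ 2 / (A * C - y ^ 2) + (C * sk - sl * z) ^ 2 / (B * C - z ^ 2)))
          / C ^ 2 * (fl - fi)) := by
  subst hdA hdB hdC hdx hdy hdz
  field_simp
  ring

/-- The inner product of two edge vectors of lengths `a`, `b` whose difference has length `p`. -/
noncomputable def gram (a b p : ℝ) : ℝ := (a ^ 2 + b ^ 2 - p ^ 2) / 2

/-- The Gram determinant of two edge vectors. -/
noncomputable def gram2 (a b p : ℝ) : ℝ := a ^ 2 * b ^ 2 - gram a b p ^ 2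

/-- The Gram determinant of three edge vectors. -/
noncomputable def gram3 (a b c p q r : ℝ) : ℝ :=
  a ^ 2 * b ^ 2 * c ^ 2 + 2 * gram a b p * gram a c q * gram b c r
    - a ^ 2 * gram b c r ^ 2 - b ^ 2 * gram a c q ^ 2 - c ^ 2 * gram a b p ^ 2

/-- The numerator of the cosine of a dihedral angle. -/
noncomputable def gramMinor (a b c p q r : ℝ) : ℝ :=
  a ^ 2 * gram b c r - gram a b p * gram a c q

theorem cmDet_eq (a b c p q r : ℝ) : cmDet a b c p q r = 8 * gram3 a b c p q r := by
  unfold cmDet gram3 gram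
  simp [Matrix.det_succ_row_zero, Fin.sum_univ_succ, Fin.succAbove]
  ring

theorem gram2_mul_gram2 (a b c p q r : ℝ) :
    gram2 a b p * gram2 a c q - gramMinor a b c p q r ^ 2 = a ^ 2 * gram3 a b c p q r := by
  unfold gram2 gramMinor gram3
  ring

theorem gram_comm (a b p : ℝ) : gram a b p = gram b a p := by
  unfold gram; ring

theorem gram2_comm (a b p : ℝ) : gram2 a b p = gram2 b a p := by
  unfold gram2 gram; ring

theorem gram3_rotate (a b c p q r : ℝ) : gram3 b c a r p q = gram3 a b c p q r := by
  unfold gram3 gram; ring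

theorem gram2_pos_or_neg {a b c p q r : ℝ} (ha : 0 < a) (hb : 0 < b)
    (hG : 0 < gram3 a b c p q r) :
    (0 < gram2 a b p ∧ 0 < gram2 a c q ∧ 0 < gram2 b c r) ∨
      (gram2 a b p < 0 ∧ gram2 a c q < 0 ∧ gram2 b c r < 0) := by
  have h1 : 0 < gram2 a b p * gram2 a c q := by
    have := gram2_mul_gram2 a b c p q r
    nlinarith [mul_pos (pow_pos ha 2) hG, sq_nonneg (gramMinor a b c p q r)]
  have h2 : 0 < gram2 a b p * gram2 b c r := by
    have := gram2_mul_gram2 b c a r p q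
    rw [gram3_rotate, gram2_comm b a] at this
    nlinarith [mul_pos (pow_pos hb 2) hG, sq_nonneg (gramMinor b c a r p q)]
  rcases mul_pos_iff.1 h1 with h | h <;> rcases mul_pos_iff.1 h2 with h' | h'
  · exact .inl ⟨h.1, h.2, h'.2⟩
  · linarith [h.1, h'.1]
  · linarith [h.1, h'.1]
  · exact .inr ⟨h.1, h.2, h'.2⟩

theorem dihedralAngle_comm (a b c p q r : ℝ) :
    dihedralAngle a b c p q r = dihedralAngle a c b q p r := by
  have h : triAngle b c r = triAngle c b r := by unfold triAngle; ring_nf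
  unfold dihedralAngle
  rw [h, mul_comm (Real.cos (triAngle a b p)), mul_comm (Real.sin (triAngle a b p))]

theorem cos_triAngle {a b p : ℝ} (ha : 0 < a) (hb : 0 < b) (h : 0 < gram2 a b p) :
    Real.cos (triAngle a b p) = gram a b p / (a * b) := by
  have e : (a ^ 2 + b ^ 2 - p ^ 2) / (2 * a * b) = gram a b p / (a * b) := by
    unfold gram; field_simp
  have h1 : |gram a b p| ≤ a * b :=
    abs_le_of_sq_le_sq (by unfold gram2 at h; nlinarith) (by positivity)
  have hab : 0 < a * b := by positivity
  rw [abs_le] at h1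
  rw [triAngle, e, Real.cos_arccos]
  · rw [le_div_iff₀ hab]; linarith
  · rw [div_le_iff₀ hab]; linarith

theorem sin_triAngle {a b p : ℝ} (ha : 0 < a) (hb : 0 < b) :
    Real.sin (triAngle a b p) = √(gram2 a b p) / (a * b) := by
  have e : (a ^ 2 + b ^ 2 - p ^ 2) / (2 * a * b) = gram a b p / (a * b) := by
    unfold gram; field_simp
  have hab : 0 < a * b := by positivity
  rw [triAngle, e, Real.sin_arccos]
  have : 1 - (gram a b p / (a * b)) ^ 2 = gram2 a b p / (a * b) ^ 2 := by
    unfold gram2; field_simp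
  rw [this, Real.sqrt_div' _ (by positivity), Real.sqrt_sq hab.le]

theorem dihedralAngle_eq {a b c p q r : ℝ} (ha : 0 < a) (hb : 0 < b) (hc : 0 < c)
    (hP : 0 < gram2 a b p) (hQ : 0 < gram2 a c q) (hR : 0 < gram2 b c r) :
    dihedralAngle a b c p q r =
      Real.arccos (gramMinor a b c p q r / √(gram2 a b p * gram2 a c q)) := by
  have h1 := Real.sqrt_pos.2 hP
  have h2 := Real.sqrt_pos.2 hQ
  rw [dihedralAngle, cos_triAngle hb hc hR, cos_triAngle ha hb hP, cos_triAngle ha hc hQ,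
    sin_triAngle ha hb, sin_triAngle ha hc, Real.sqrt_mul hP.le]
  congr 1
  unfold gramMinor
  field_simp

theorem dihedralAngle_eq_of_neg {a b c p q r : ℝ} (ha : 0 < a) (hb : 0 < b)
    (hP : gram2 a b p < 0) : dihedralAngle a b c p q r = Real.pi / 2 := by
  rw [dihedralAngle, sin_triAngle ha hb, Real.sqrt_eq_zero_of_nonpos hP.le]
  simp

theorem cos_dihedralAngle {a b c p q r : ℝ} (ha : 0 < a) (hb : 0 < b) (hc : 0 < c)
    (hP : 0 < gram2 a b p) (hQ : 0 < gram2 a c q) (hR : 0 < gram2 b c r)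
    (hG : 0 < gram3 a b c p q r) :
    Real.cos (dihedralAngle a b c p q r) =
      gramMinor a b c p q r / √(gram2 a b p * gram2 a c q) := by
  have hPQ := mul_pos hP hQ
  have hs := Real.sqrt_pos.2 hPQ
  have h0 := gram2_mul_gram2 a b c p q r
  have h1 : |gramMinor a b c p q r| ≤ √(gram2 a b p * gram2 a c q) := by
    apply Real.abs_le_sqrt
    nlinarith [mul_pos (pow_pos ha 2) hG]
  rw [abs_le] at h1
  rw [dihedralAngle_eq ha hb hc hP hQ hR, Real.cos_arccos]
  · rw [le_div_iff₀ hs]; linarith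
  · rw [div_le_iff₀ hs]; linarith

theorem one_sub_div_sqrt_sq {M P Q : ℝ} (hPQ : 0 < P * Q) :
    1 - (M / √(P * Q)) ^ 2 = (P * Q - M ^ 2) / (P * Q) := by
  rw [div_pow, Real.sq_sqrt hPQ.le, sub_div, div_self hPQ.ne']

theorem sin_dihedralAngle {a b c p q r : ℝ} (ha : 0 < a) (hb : 0 < b) (hc : 0 < c)
    (hP : 0 < gram2 a b p) (hQ : 0 < gram2 a c q) (hR : 0 < gram2 b c r) :
    Real.sin (dihedralAngle a b c p q r) =
      a * √(gram3 a b c p q r) / √(gram2 a b p * gram2 a c q) := by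
  have hPQ := mul_pos hP hQ
  rw [dihedralAngle_eq ha hb hc hP hQ hR, Real.sin_arccos, one_sub_div_sqrt_sq hPQ,
    gram2_mul_gram2, Real.sqrt_div' _ hPQ.le, Real.sqrt_mul (by positivity), Real.sqrt_sq ha.le]

theorem hasDerivAt_arccos_div_sqrt {M P Q : ℝ → ℝ} {dM dP dQ t : ℝ}
    (hM : HasDerivAt M dM t) (hP : HasDerivAt P dP t) (hQ : HasDerivAt Q dQ t)
    (hP0 : 0 < P t) (hQ0 : 0 < Q t) (h : 0 < P t * Q t - M t ^ 2) :
    HasDerivAt (fun s => Real.arccos (M s / √(P s * Q s)))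
      (-(dM - M t * (dP / P t + dQ / Q t) / 2) / √(P t * Q t - M t ^ 2)) t := by
  have hPQ := mul_pos hP0 hQ0
  have hs := Real.sqrt_pos.2 hPQ
  have hw := Real.sqrt_pos.2 h
  have h1 := one_sub_div_sqrt_sq (M := M t) hPQ
  have h2 : 0 < 1 - (M t / √(P t * Q t)) ^ 2 := by rw [h1]; positivity
  have hd := hM.div ((hP.mul hQ).sqrt hPQ.ne') hs.ne'
  have := (Real.hasDerivAt_arccos (x := M t / √(P t * Q t)) (by nlinarith) (by nlinarith)).comp t hd
  refine this.congr_deriv ?_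
  simp only [Pi.mul_apply]
  rw [h1, Real.sqrt_div' _ hPQ.le]
  have e : P t * Q t = √(P t * Q t) ^ 2 := (Real.sq_sqrt hPQ.le).symm
  generalize √(P t * Q t) = w at *
  field_simp
  rw [← e]

theorem hasDerivAt_dihedralAngle {a b c p q r : ℝ → ℝ} {t dA dB dC dx dy dz : ℝ}
    (ha : ∀ᶠ s in nhds t, 0 < a s) (hb : ∀ᶠ s in nhds t, 0 < b s)
    (hc : ∀ᶠ s in nhds t, 0 < c s)
    (hA : HasDerivAt (fun s => a s ^ 2) dA t) (hB : HasDerivAt (fun s => b s ^ 2) dB t)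
    (hC : HasDerivAt (fun s => c s ^ 2) dC t)
    (hx : HasDerivAt (fun s => gram (a s) (b s) (p s)) dx t)
    (hy : HasDerivAt (fun s => gram (a s) (c s) (q s)) dy t)
    (hz : HasDerivAt (fun s => gram (b s) (c s) (r s)) dz t)
    (hP : 0 < gram2 (a t) (b t) (p t)) (hQ : 0 < gram2 (a t) (c t) (q t))
    (hR : 0 < gram2 (b t) (c t) (r t))
    (hG : 0 < gram3 (a t) (b t) (c t) (p t) (q t) (r t)) :
    HasDerivAt (fun s => dihedralAngle (a s) (b s) (c s) (p s) (q s) (r s))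
      (-((dA * gram (b t) (c t) (r t) + a t ^ 2 * dz - dx * gram (a t) (c t) (q t)
          - gram (a t) (b t) (p t) * dy) - gramMinor (a t) (b t) (c t) (p t) (q t) (r t) *
        ((dA * b t ^ 2 + a t ^ 2 * dB - 2 * gram (a t) (b t) (p t) * dx)
            / gram2 (a t) (b t) (p t) +
          (dA * c t ^ 2 + a t ^ 2 * dC - 2 * gram (a t) (c t) (q t) * dy)
            / gram2 (a t) (c t) (q t)) / 2) /
        (a t * √(gram3 (a t) (b t) (c t) (p t) (q t) (r t)))) t := by
  have ha0 := ha.self_of_nhds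
  have hP' : HasDerivAt (fun s => gram2 (a s) (b s) (p s)) _ t := (hA.mul hB).sub (hx.pow 2)
  have hQ' : HasDerivAt (fun s => gram2 (a s) (c s) (q s)) _ t := (hA.mul hC).sub (hy.pow 2)
  have hR' : HasDerivAt (fun s => gram2 (b s) (c s) (r s)) _ t := (hB.mul hC).sub (hz.pow 2)
  have hM' : HasDerivAt (fun s => gramMinor (a s) (b s) (c s) (p s) (q s) (r s)) _ t :=
    (hA.mul hz).sub (hx.mul hy)
  have key := hasDerivAt_arccos_div_sqrt hM' hP' hQ' hP hQ
    (by rw [gram2_mul_gram2]; positivity)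
  rw [gram2_mul_gram2, Real.sqrt_mul (by positivity), Real.sqrt_sq ha0.le] at key
  refine (key.congr_of_eventuallyEq ?_).congr_deriv ?_
  · filter_upwards [ha, hb, hc, hP'.continuousAt.eventually (lt_mem_nhds hP),
      hQ'.continuousAt.eventually (lt_mem_nhds hQ),
      hR'.continuousAt.eventually (lt_mem_nhds hR)] with s h1 h2 h3 h4 h5 h6
    exact dihedralAngle_eq h1 h2 h3 h4 h5 h6
  · simp only [Nat.reduceSub, pow_one, Nat.cast_ofNat]
    ring

end Conformal3D

theorem IsEdge.symm {V : Type*} [DecidableEq V] {𝒯 : Finset (Finset V)} {i j : V}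
    (h : IsEdge 𝒯 i j) : IsEdge 𝒯 j i :=
  ⟨h.1.symm, let ⟨T, hT, h1, h2⟩ := h.2; ⟨T, hT, h2, h1⟩⟩

namespace Conformal3D

variable {V : Type*} [DecidableEq V] {𝒯 : Finset (Finset V)}

/-- The vertices `i, j, k, l` are distinct and span a member of `𝒯`. -/
def IsTet (𝒯 : Finset (Finset V)) (i j k l : V) : Prop :=
  ({i, j, k, l} : Finset V) ∈ 𝒯 ∧ i ≠ j ∧ i ≠ k ∧ i ≠ l ∧ j ≠ k ∧ j ≠ l ∧ k ≠ l

theorem IsTet.rotate {i j k l : V} (h : IsTet 𝒯 i j k l) : IsTet 𝒯 i k l j := by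
  obtain ⟨hT, hij, hik, hil, hjk, hjl, hkl⟩ := h
  refine ⟨?_, hik, hil, hij, hkl, hjk.symm, hjl.symm⟩
  convert hT using 1
  ext m
  simp only [Finset.mem_insert, Finset.mem_singleton]
  tauto

theorem IsTet.edge_left {i j k l : V} (h : IsTet 𝒯 i j k l) : IsEdge 𝒯 i j :=
  ⟨h.2.1, _, h.1, by simp, by simp⟩

theorem IsTet.edge_right {i j k l : V} (h : IsTet 𝒯 i j k l) : IsEdge 𝒯 j k :=
  ⟨h.2.2.2.2.1, _, h.1, by simp, by simp⟩

variable [Fintype V] {U : Set (V → ℝ)}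

theorem len_comm (C : Conformal3D V 𝒯 U) (g : V → ℝ) (i j : V) : C.len g i j = C.len g j i :=
  add_comm _ _

theorem contDiffAt_d (C : Conformal3D V 𝒯 U) {i j : V} (h : IsEdge 𝒯 i j) {g : V → ℝ}
    (hg : g ∈ U) : ContDiffAt ℝ 2 (fun f => C.d f i j) g :=
  ((C.smooth i j h).contDiffAt (C.openU.mem_nhds hg)).of_le
    (WithTop.coe_le_coe.2 (le_top : (2 : ℕ∞) ≤ ⊤))

theorem differentiableAt_d (C : Conformal3D V 𝒯 U) {i j : V} (h : IsEdge 𝒯 i j) {g : V → ℝ}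
    (hg : g ∈ U) : DifferentiableAt ℝ (fun f => C.d f i j) g :=
  (C.contDiffAt_d h hg).differentiableAt (by simp)

theorem hasDerivAt_comp_update {φ : (V → ℝ) → ℝ} {g : V → ℝ} (hφ : DifferentiableAt ℝ φ g)
    (m : V) :
    HasDerivAt (fun s : ℝ => φ (Function.update g m s)) (fderiv ℝ φ g (Pi.single m 1)) (g m) := by
  refine HasFDerivAt.comp_hasDerivAt (g m) ?_ (hasDerivAt_update g m (g m))
  rw [Function.update_eq_self]
  exact hφ.hasFDerivAt

theorem fderiv_d_single_right (C : Conformal3D V 𝒯 U) {i j : V} (h : IsEdge 𝒯 i j)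
    {g : V → ℝ} (hg : g ∈ U) :
    fderiv ℝ (fun f => C.d f i j) g (Pi.single j 1) = C.qq g i j :=
  (hasDerivAt_comp_update (C.differentiableAt_d h hg) j).deriv.symm

theorem fderiv_len_single (C : Conformal3D V 𝒯 U) {i j : V} (h : IsEdge 𝒯 i j)
    {g : V → ℝ} (hg : g ∈ U) :
    fderiv ℝ (fun f => C.len f i j) g (Pi.single i 1) = C.d g i j :=
  (hasDerivAt_comp_update ((C.differentiableAt_d h hg).add (C.differentiableAt_d h.symm hg))
    i).unique (C.derivLen i j h g hg)

theorem qq_eq_fderiv_fderiv (C : Conformal3D V 𝒯 U) {i j : V} (h : IsEdge 𝒯 i j)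
    {g : V → ℝ} (hg : g ∈ U) :
    C.qq g i j =
      fderiv ℝ (fderiv ℝ (fun f => C.len f i j)) g (Pi.single j 1) (Pi.single i 1) := by
  have hL : ContDiffAt ℝ 2 (fun f => C.len f i j) g :=
    (C.contDiffAt_d h hg).add (C.contDiffAt_d h.symm hg)
  have hd : DifferentiableAt ℝ (fderiv ℝ (fun f => C.len f i j)) g :=
    (hL.fderiv_right (m := 1) (by norm_num)).differentiableAt (by simp)
  have he : (fun f => C.d f i j) =ᶠ[nhds g]
      fun f => fderiv ℝ (fun f => C.len f i j) f (Pi.single i 1) := by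
    filter_upwards [C.openU.mem_nhds hg] with f hf using (C.fderiv_len_single h hf).symm
  rw [← C.fderiv_d_single_right h hg, he.fderiv_eq,
    (hd.hasFDerivAt.clm_apply (hasFDerivAt_const (Pi.single i (1 : ℝ)) g)).fderiv]
  simp

theorem qq_comm (C : Conformal3D V 𝒯 U) {i j : V} (h : IsEdge 𝒯 i j)
    {g : V → ℝ} (hg : g ∈ U) : C.qq g i j = C.qq g j i := by
  have hL : ContDiffAt ℝ 2 (fun f => C.len f i j) g :=
    (C.contDiffAt_d h hg).add (C.contDiffAt_d h.symm hg)
  have hs : IsSymmSndFDerivAt ℝ (fun f => C.len f i j) g :=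
    hL.isSymmSndFDerivAt (by simp)
  rw [C.qq_eq_fderiv_fderiv h hg, C.qq_eq_fderiv_fderiv h.symm hg, hs.eq]
  simp only [C.len_comm _ i j]

theorem fderiv_d_apply (C : Conformal3D V 𝒯 U) {i j : V} (h : IsEdge 𝒯 i j)
    {g : V → ℝ} (hg : g ∈ U) (w : V → ℝ) :
    fderiv ℝ (fun f => C.d f i j) g w = C.d g i j * w i + C.qq g i j * (w j - w i) := by
  have hdij := C.differentiableAt_d h hg
  have hdji := C.differentiableAt_d h.symm hg
  have hleft : fderiv ℝ (fun f => C.d f i j) g (Pi.single i 1) = C.d g i j - C.qq g i j := by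
    have h1 := C.fderiv_len_single h hg
    have h2 : fderiv ℝ (fun f => C.len f i j) g =
        fderiv ℝ (fun f => C.d f i j) g + fderiv ℝ (fun f => C.d f j i) g := fderiv_add hdij hdji
    rw [h2, add_apply, C.fderiv_d_single_right h.symm hg,
      ← C.qq_comm h hg] at h1
    linarith
  have hzero : ∀ u : V → ℝ, u i = 0 → u j = 0 → fderiv ℝ (fun f => C.d f i j) g u = 0 := by
    intro u hi hj
    have hline : HasDerivAt (fun s : ℝ => g + s • u) u 0 := by
      have h0 : HasDerivAt (fun s : ℝ => s • u) ((1 : ℝ) • u) 0 :=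
        (hasDerivAt_id (0 : ℝ)).smul_const u
      simpa using h0.const_add g
    have hcomp : HasDerivAt (fun s : ℝ => C.d (g + s • u) i j)
        (fderiv ℝ (fun f => C.d f i j) g u) 0 := by
      refine HasFDerivAt.comp_hasDerivAt (l := fun f => C.d f i j) (0 : ℝ) ?_ hline
      simpa using hdij.hasFDerivAt
    have hconst : (fun s : ℝ => C.d (g + s • u) i j) = fun _ => C.d g i j := by
      funext s
      exact C.localDep i j h _ _ (by simp [hi]) (by simp [hj])
    rw [hconst] at hcomp
    exact hcomp.unique (hasDerivAt_const _ _)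
  have hne := h.1
  have hw := hzero (w - w i • Pi.single i 1 - w j • Pi.single j 1)
    (by simp [hne]) (by simp [hne.symm])
  rw [map_sub, map_sub, map_smul, map_smul, hleft, C.fderiv_d_single_right h hg,
    smul_eq_mul, smul_eq_mul] at hw
  linarith

section Curve

variable (C : Conformal3D V 𝒯 U) {f : ℝ → V → ℝ} {t : ℝ} {v : V → ℝ}

theorem hasDerivAt_d (hft : f t ∈ U) (hf : HasDerivAt f v t) {i j : V} (h : IsEdge 𝒯 i j) :
    HasDerivAt (fun s => C.d (f s) i j)
      (C.d (f t) i j * v i + C.qq (f t) i j * (v j - v i)) t := by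
  rw [← C.fderiv_d_apply h hft]
  exact (C.differentiableAt_d h hft).hasFDerivAt.comp_hasDerivAt t hf

theorem hasDerivAt_len_sq (hft : f t ∈ U) (hf : HasDerivAt f v t) {i j : V}
    (h : IsEdge 𝒯 i j) :
    HasDerivAt (fun s => C.len (f s) i j ^ 2)
      (2 * (C.len (f t) i j * C.d (f t) i j * v i + C.len (f t) i j * C.d (f t) j i * v j)) t := by
  refine (((C.hasDerivAt_d hft hf h).add (C.hasDerivAt_d hft hf h.symm)).pow 2).congr_deriv ?_
  rw [← C.qq_comm h hft]
  simp only [Pi.add_apply, len]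
  ring

end Curve

/-- The inner product at `i` of the edge vectors towards `j` and `k`. -/
noncomputable def inn (C : Conformal3D V 𝒯 U) (g : V → ℝ) (i j k : V) : ℝ :=
  gram (C.len g i j) (C.len g i k) (C.len g j k)

theorem inn_comm (C : Conformal3D V 𝒯 U) (g : V → ℝ) (i j k : V) :
    C.inn g i j k = C.inn g i k j := by
  rw [inn, inn, gram_comm, C.len_comm g j k]

/-- The Gram determinant of the edge vectors at `i` towards `j`, `k`, `l`. -/
noncomputable def vol (C : Conformal3D V 𝒯 U) (g : V → ℝ) (i j k l : V) : ℝ :=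
  gram3 (C.len g i j) (C.len g i k) (C.len g i l)
    (C.len g j k) (C.len g j l) (C.len g k l)

theorem vol_rotate (C : Conformal3D V 𝒯 U) (g : V → ℝ) (i j k l : V) :
    C.vol g i k l j = C.vol g i j k l := by
  rw [vol, vol, C.len_comm g k j, C.len_comm g l j, gram3_rotate]

theorem vol_pos (C : Conformal3D V 𝒯 U) {g : V → ℝ} (hg : g ∈ U) {i j k l : V}
    (h : IsTet 𝒯 i j k l) : 0 < C.vol g i j k l := by
  obtain ⟨hT, hij, hik, hil, hjk, hjl, hkl⟩ := h
  have := C.nondeg g hg _ hT i (by simp) j (by simp) k (by simp) l (by simp)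
    hij hik hil hjk hjl hkl
  rw [cmDet_eq] at this
  unfold vol len
  linarith

/-- The inner product with the edge vector from `i` to `j` of the vector from `i` to the centre
of the metric. -/
noncomputable def mom (C : Conformal3D V 𝒯 U) (g : V → ℝ) (i j : V) : ℝ :=
  C.len g i j * C.d g i j

theorem beta_comm (C : Conformal3D V 𝒯 U) (g : V → ℝ) (i j k l : V) :
    C.beta g i j l k = C.beta g i j k l := by
  rw [beta, beta, dihedralAngle_comm, C.len_comm g l k]

theorem hf_eq (C : Conformal3D V 𝒯 U) {g : V → ℝ} {i j k : V}
    (hij : 0 < C.len g i j) (hik : 0 < C.len g i k)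
    (hP : 0 < C.len g i j ^ 2 * C.len g i k ^ 2 - C.inn g i j k ^ 2) :
    C.hf g i j k = (C.len g i j ^ 2 * C.mom g i k - C.mom g i j * C.inn g i j k) /
      (C.len g i j * √(C.len g i j ^ 2 * C.len g i k ^ 2 - C.inn g i j k ^ 2)) := by
  have hs := Real.sqrt_pos.2 hP
  rw [hf, fang, cos_triAngle hij hik hP, sin_triAngle hij hik]
  change (_ - _ * (C.inn g i j k / _)) /
    (√(C.len g i j ^ 2 * C.len g i k ^ 2 - C.inn g i j k ^ 2) / _) = _
  unfold mom
  field_simp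

theorem hf_eq_zero (C : Conformal3D V 𝒯 U) {g : V → ℝ} {i j k : V}
    (hij : 0 < C.len g i j) (hik : 0 < C.len g i k)
    (hP : gram2 (C.len g i j) (C.len g i k) (C.len g j k) < 0) : C.hf g i j k = 0 := by
  rw [hf, fang, sin_triAngle hij hik, Real.sqrt_eq_zero_of_nonpos hP.le]
  simp

theorem two_mul_Aq_div_len (C : Conformal3D V 𝒯 U) {g : V → ℝ} {i j k l : V}
    (hij : 0 < C.len g i j) (hik : 0 < C.len g i k) (hil : 0 < C.len g i l)
    (hP : 0 < C.len g i j ^ 2 * C.len g i k ^ 2 - C.inn g i j k ^ 2)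
    (hQ : 0 < C.len g i j ^ 2 * C.len g i l ^ 2 - C.inn g i j l ^ 2)
    (hR : 0 < C.len g i k ^ 2 * C.len g i l ^ 2 - C.inn g i k l ^ 2)
    (hG : 0 < C.vol g i j k l) :
    2 * C.Aq g i j k l / C.len g i j =
      (2 * (C.len g i j ^ 2 * C.mom g i k - C.mom g i j * C.inn g i j k) *
          (C.len g i j ^ 2 * C.mom g i l - C.mom g i j * C.inn g i j l) -
        (C.len g i j ^ 2 * C.inn g i k l - C.inn g i j k * C.inn g i j l) *
          ((C.len g i j ^ 2 * C.mom g i k - C.mom g i j * C.inn g i j k) ^ 2 /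
              (C.len g i j ^ 2 * C.len g i k ^ 2 - C.inn g i j k ^ 2) +
            (C.len g i j ^ 2 * C.mom g i l - C.mom g i j * C.inn g i j l) ^ 2 /
              (C.len g i j ^ 2 * C.len g i l ^ 2 - C.inn g i j l ^ 2))) /
        (C.len g i j ^ 2) ^ 2 / √(C.vol g i j k l) := by
  have hcos : Real.cos (C.beta g i j k l) =
      (C.len g i j ^ 2 * C.inn g i k l - C.inn g i j k * C.inn g i j l) /
        √((C.len g i j ^ 2 * C.len g i k ^ 2 - C.inn g i j k ^ 2) *
          (C.len g i j ^ 2 * C.len g i l ^ 2 - C.inn g i j l ^ 2)) :=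
    cos_dihedralAngle hij hik hil hP hQ hR hG
  have hsin : Real.sin (C.beta g i j k l) = C.len g i j * √(C.vol g i j k l) /
        √((C.len g i j ^ 2 * C.len g i k ^ 2 - C.inn g i j k ^ 2) *
          (C.len g i j ^ 2 * C.len g i l ^ 2 - C.inn g i j l ^ 2)) :=
    sin_dihedralAngle hij hik hil hP hQ hR
  rw [Aq, ht, ht, C.beta_comm g i j k l, hcos, hsin, C.hf_eq hij hik hP, C.hf_eq hij hil hQ,
    Real.sqrt_mul hP.le]
  have hsP := Real.sqrt_pos.2 hP
  have hsQ := Real.sqrt_pos.2 hQ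
  have hsG := Real.sqrt_pos.2 hG
  have eP := Real.sq_sqrt hP.le
  have eQ := Real.sq_sqrt hQ.le
  generalize √(C.vol g i j k l) = w at *
  generalize √(C.len g i j ^ 2 * C.len g i k ^ 2 - C.inn g i j k ^ 2) = u at *
  generalize √(C.len g i j ^ 2 * C.len g i l ^ 2 - C.inn g i j l ^ 2) = u' at *
  rw [← eP, ← eQ]
  field_simp
  ring

theorem Aq_eq_zero (C : Conformal3D V 𝒯 U) {g : V → ℝ} {i j k l : V}
    (hij : 0 < C.len g i j) (hik : 0 < C.len g i k) (hil : 0 < C.len g i l)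
    (hP : gram2 (C.len g i j) (C.len g i k) (C.len g j k) < 0)
    (hQ : gram2 (C.len g i j) (C.len g i l) (C.len g j l) < 0) : C.Aq g i j k l = 0 := by
  rw [Aq, C.hf_eq_zero hij hik hP, C.hf_eq_zero hij hil hQ]
  simp

section Curve

variable (C : Conformal3D V 𝒯 U) {f : ℝ → V → ℝ} {t : ℝ} {v : V → ℝ}

theorem hasDerivAt_inn (hft : f t ∈ U) (hf : HasDerivAt f v t) {i j k l : V}
    (h : IsTet 𝒯 i j k l) :
    HasDerivAt (fun s => C.inn (f s) i j k)
      ((C.mom (f t) i j + C.mom (f t) i k) * v i + (C.inn (f t) i j k - C.mom (f t) i k) * v j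
        + (C.inn (f t) i j k - C.mom (f t) i j) * v k) t := by
  have hmet := C.metricCond (f t) hft _ h.1 i (by simp) j (by simp) k (by simp)
    h.2.1 h.2.2.1 h.2.2.2.2.1
  refine ((((C.hasDerivAt_len_sq hft hf h.edge_left).add
    (C.hasDerivAt_len_sq hft hf h.rotate.edge_left)).sub
    (C.hasDerivAt_len_sq hft hf h.edge_right)).div_const 2).congr_deriv ?_
  unfold mom inn gram len
  linear_combination (v k - v j) / 2 * hmet

theorem eventually_len_pos (hft : f t ∈ U) (hf : HasDerivAt f v t) {i j : V}
    (h : IsEdge 𝒯 i j) : ∀ᶠ s in nhds t, 0 < C.len (f s) i j :=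
  (hf.continuousAt.eventually (C.openU.mem_nhds hft)).mono fun _ hs => C.lenPos _ hs i j h

theorem hasDerivAt_beta (hft : f t ∈ U) (hf : HasDerivAt f v t) {i j k l : V}
    (h : IsTet 𝒯 i j k l)
    (hP : 0 < C.len (f t) i j ^ 2 * C.len (f t) i k ^ 2 - C.inn (f t) i j k ^ 2)
    (hQ : 0 < C.len (f t) i j ^ 2 * C.len (f t) i l ^ 2 - C.inn (f t) i j l ^ 2)
    (hR : 0 < C.len (f t) i k ^ 2 * C.len (f t) i l ^ 2 - C.inn (f t) i k l ^ 2)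
    {dA dB dC dx dy dz : ℝ}
    (hA : HasDerivAt (fun s => C.len (f s) i j ^ 2) dA t)
    (hB : HasDerivAt (fun s => C.len (f s) i k ^ 2) dB t)
    (hC : HasDerivAt (fun s => C.len (f s) i l ^ 2) dC t)
    (hx : HasDerivAt (fun s => C.inn (f s) i j k) dx t)
    (hy : HasDerivAt (fun s => C.inn (f s) i j l) dy t)
    (hz : HasDerivAt (fun s => C.inn (f s) i k l) dz t) :
    HasDerivAt (fun s => C.beta (f s) i j k l)
      (-((dA * C.inn (f t) i k l + C.len (f t) i j ^ 2 * dz - dx * C.inn (f t) i j l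
          - C.inn (f t) i j k * dy) -
        (C.len (f t) i j ^ 2 * C.inn (f t) i k l - C.inn (f t) i j k * C.inn (f t) i j l) *
        ((dA * C.len (f t) i k ^ 2 + C.len (f t) i j ^ 2 * dB - 2 * C.inn (f t) i j k * dx)
            / (C.len (f t) i j ^ 2 * C.len (f t) i k ^ 2 - C.inn (f t) i j k ^ 2) +
          (dA * C.len (f t) i l ^ 2 + C.len (f t) i j ^ 2 * dC - 2 * C.inn (f t) i j l * dy)
            / (C.len (f t) i j ^ 2 * C.len (f t) i l ^ 2 - C.inn (f t) i j l ^ 2)) / 2) /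
        (C.len (f t) i j * √(C.vol (f t) i j k l))) t :=
  hasDerivAt_dihedralAngle (C.eventually_len_pos hft hf h.edge_left)
    (C.eventually_len_pos hft hf h.rotate.edge_left)
    (C.eventually_len_pos hft hf h.rotate.rotate.edge_left) hA hB hC hx hy hz hP hQ hR
    (C.vol_pos hft h)

theorem hasDerivAt_beta_of_neg (hft : f t ∈ U) (hf : HasDerivAt f v t) {i j k l : V}
    (h : IsTet 𝒯 i j k l)
    (hP : gram2 (C.len (f t) i j) (C.len (f t) i k) (C.len (f t) j k) < 0) :
    HasDerivAt (fun s => C.beta (f s) i j k l) 0 t := by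
  have hA := (C.hasDerivAt_len_sq hft hf h.edge_left).continuousAt
  have hB := (C.hasDerivAt_len_sq hft hf h.rotate.edge_left).continuousAt
  have hx := (C.hasDerivAt_inn hft hf h).continuousAt
  have hP' : ContinuousAt
      (fun s => gram2 (C.len (f s) i j) (C.len (f s) i k) (C.len (f s) j k)) t :=
    (hA.mul hB).sub (hx.pow 2)
  refine (hasDerivAt_const t (Real.pi / 2)).congr_of_eventuallyEq ?_
  filter_upwards [C.eventually_len_pos hft hf h.edge_left,
    C.eventually_len_pos hft hf h.rotate.edge_left,
    hP'.eventually (gt_mem_nhds hP)] with s h1 h2 h3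
  exact dihedralAngle_eq_of_neg h1 h2 h3

theorem exists_hasDerivAt_beta (hft : f t ∈ U) (hf : HasDerivAt f v t) {i j k l : V}
    (h : IsTet 𝒯 i j k l) :
    ∃ bj bk bl : ℝ,
      HasDerivAt (fun s => C.beta (f s) i j k l) bj t ∧
      HasDerivAt (fun s => C.beta (f s) i k l j) bk t ∧
      HasDerivAt (fun s => C.beta (f s) i l j k) bl t ∧
      C.d (f t) i j * bj + C.d (f t) i k * bk + C.d (f t) i l * bl =
        2 * C.Aq (f t) i j k l / C.len (f t) i j * (v j - v i) +
        2 * C.Aq (f t) i k l j / C.len (f t) i k * (v k - v i) +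
        2 * C.Aq (f t) i l j k / C.len (f t) i l * (v l - v i) := by
  have hj := C.lenPos _ hft _ _ h.edge_left
  have hk := C.lenPos _ hft _ _ h.rotate.edge_left
  have hl := C.lenPos _ hft _ _ h.rotate.rotate.edge_left
  have hG := C.vol_pos hft h
  rcases gram2_pos_or_neg hj hk hG with ⟨hP, hQ, hR⟩ | ⟨hP, hQ, hR⟩
  · change 0 < C.len (f t) i j ^ 2 * C.len (f t) i k ^ 2 - C.inn (f t) i j k ^ 2 at hP
    change 0 < C.len (f t) i j ^ 2 * C.len (f t) i l ^ 2 - C.inn (f t) i j l ^ 2 at hQ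
    change 0 < C.len (f t) i k ^ 2 * C.len (f t) i l ^ 2 - C.inn (f t) i k l ^ 2 at hR
    change 0 < C.len (f t) i j at hj
    change 0 < C.len (f t) i k at hk
    change 0 < C.len (f t) i l at hl
    have hP' : 0 < C.len (f t) i k ^ 2 * C.len (f t) i j ^ 2 - C.inn (f t) i k j ^ 2 := by
      rw [C.inn_comm, mul_comm]; exact hP
    have hQ' : 0 < C.len (f t) i l ^ 2 * C.len (f t) i j ^ 2 - C.inn (f t) i l j ^ 2 := by
      rw [C.inn_comm, mul_comm]; exact hQ
    have hR' : 0 < C.len (f t) i l ^ 2 * C.len (f t) i k ^ 2 - C.inn (f t) i l k ^ 2 := by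
      rw [C.inn_comm, mul_comm]; exact hR
    have hA := C.hasDerivAt_len_sq hft hf h.edge_left
    have hB := C.hasDerivAt_len_sq hft hf h.rotate.edge_left
    have hC := C.hasDerivAt_len_sq hft hf h.rotate.rotate.edge_left
    have hx := C.hasDerivAt_inn hft hf h
    have hz := C.hasDerivAt_inn hft hf h.rotate
    have hy' := C.hasDerivAt_inn hft hf h.rotate.rotate
    have hx' := hx
    have hz' := hz
    have hy := hy'
    simp only [C.inn_comm _ i l j] at hy
    simp only [C.inn_comm _ i j k] at hx'
    simp only [C.inn_comm _ i k l] at hz'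
    have hGk : 0 < C.vol (f t) i k l j := by rwa [C.vol_rotate]
    have hGl : 0 < C.vol (f t) i l j k := by rwa [C.vol_rotate, C.vol_rotate]
    refine ⟨_, _, _, C.hasDerivAt_beta hft hf h hP hQ hR hA hB hC hx hy hz,
      C.hasDerivAt_beta hft hf h.rotate hR hP' hQ' hB hC hA hz hx' hy',
      C.hasDerivAt_beta hft hf h.rotate.rotate hQ' hR' hP hC hA hB hy' hz' hx, ?_⟩
    have key := gram_cyclic_identity (C.len (f t) i j ^ 2) (C.len (f t) i k ^ 2)
      (C.len (f t) i l ^ 2) (C.inn (f t) i j k) (C.inn (f t) i j l) (C.inn (f t) i k l)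
      (C.mom (f t) i j) (C.mom (f t) i k) (C.mom (f t) i l) (v i) (v j) (v k) (v l)
      (by positivity) (by positivity) (by positivity) hP.ne' hQ.ne' hR.ne' _ _ _ _ _ _
      rfl rfl rfl rfl rfl rfl
    rw [C.two_mul_Aq_div_len hj hk hl hP hQ hR hG,
      C.two_mul_Aq_div_len hk hl hj hR hP' hQ' hGk,
      C.two_mul_Aq_div_len hl hj hk hQ' hR' hP hGl]
    have ed : ∀ m, C.len (f t) i m * C.d (f t) m i = C.len (f t) i m ^ 2 - C.mom (f t) i m := by
      intro m; unfold mom len; ring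
    have em : ∀ m, C.len (f t) i m * C.d (f t) i m = C.mom (f t) i m := fun _ => rfl
    have eq : ∀ m, 0 < C.len (f t) i m → ∀ X Y : ℝ,
        C.d (f t) i m * (-X / (C.len (f t) i m * Y)) =
          -(C.mom (f t) i m / C.len (f t) i m ^ 2 * X) * Y⁻¹ := by
      intro m hm X Y
      rw [← em]
      field_simp
    rw [eq j hj, eq k hk, eq l hl]
    simp only [C.vol_rotate, ed, em, C.inn_comm _ i l j, C.inn_comm _ i k j, C.inn_comm _ i l k]
    simp only [div_eq_mul_inv _ (√(C.vol (f t) i j k l))]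
    rw [mul_comm (C.len (f t) i k ^ 2) (C.len (f t) i j ^ 2),
      mul_comm (C.len (f t) i l ^ 2) (C.len (f t) i j ^ 2),
      mul_comm (C.len (f t) i l ^ 2) (C.len (f t) i k ^ 2)]
    linear_combination (-(√(C.vol (f t) i j k l))⁻¹) * key
  · have hP' : gram2 (C.len (f t) i k) (C.len (f t) i j) (C.len (f t) k j) < 0 := by
      rw [gram2_comm, C.len_comm _ k j]; exact hP
    have hQ' : gram2 (C.len (f t) i l) (C.len (f t) i j) (C.len (f t) l j) < 0 := by
      rw [gram2_comm, C.len_comm _ l j]; exact hQ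
    have hR' : gram2 (C.len (f t) i l) (C.len (f t) i k) (C.len (f t) l k) < 0 := by
      rw [gram2_comm, C.len_comm _ l k]; exact hR
    refine ⟨0, 0, 0, C.hasDerivAt_beta_of_neg hft hf h hP,
      C.hasDerivAt_beta_of_neg hft hf h.rotate hR,
      C.hasDerivAt_beta_of_neg hft hf h.rotate.rotate hQ', ?_⟩
    rw [C.Aq_eq_zero hj hk hl hP hQ, C.Aq_eq_zero hk hl hj hR hP',
      C.Aq_eq_zero hl hj hk hQ' hR']
    simp

theorem hasDerivAt_angSum (hft : f t ∈ U) (hf : HasDerivAt f v t) (i j : V) :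
    HasDerivAt (fun s => C.angSum (f s) i j)
      ((1 / 2) * ∑ k : V, ∑ l : V,
        if ({i, j, k, l} : Finset V) ∈ 𝒯 ∧ i ≠ j ∧ i ≠ k ∧ i ≠ l ∧ j ≠ k ∧ j ≠ l ∧ k ≠ l
        then deriv (fun s => C.beta (f s) i j k l) t else 0) t := by
  refine HasDerivAt.const_mul _ (HasDerivAt.fun_sum fun k _ => HasDerivAt.fun_sum fun l _ => ?_)
  split_ifs with h
  · obtain ⟨bj, bk, bl, hj, -⟩ := C.exists_hasDerivAt_beta hft hf h
    exact hj.differentiableAt.hasDerivAt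
  · exact hasDerivAt_const _ _

/-- The Schläfli-type identity for conformal variations, summed over the edges at `i`. -/
theorem sum_d_mul_deriv_angSum (hft : f t ∈ U) (hf : HasDerivAt f v t) (i : V) :
    (∑ j, if IsEdge 𝒯 i j then C.d (f t) i j * deriv (fun s => C.angSum (f s) i j) t else 0) =
      ∑ j, if IsEdge 𝒯 i j then
        2 * C.dualLen (f t) i j / C.len (f t) i j * (v j - v i) else 0 := by
  have hcyc : ∑ j, ∑ k, ∑ l, (if ({i, j, k, l} : Finset V) ∈ 𝒯 ∧
      i ≠ j ∧ i ≠ k ∧ i ≠ l ∧ j ≠ k ∧ j ≠ l ∧ k ≠ l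
      then C.d (f t) i j * deriv (fun s => C.beta (f s) i j k l) t -
        2 * C.Aq (f t) i j k l / C.len (f t) i j * (v j - v i) else 0) = 0 := by
    refine sum_sum_sum_eq_zero_of_cyclic fun j k l => ?_
    by_cases h : IsTet 𝒯 i j k l
    · obtain ⟨bj, bk, bl, hj, hk, hl, hsum⟩ := C.exists_hasDerivAt_beta hft hf h
      have h1 := h.rotate
      have h2 := h.rotate.rotate
      unfold IsTet at h h1 h2
      rw [if_pos h, if_pos h1, if_pos h2, hj.deriv, hk.deriv, hl.deriv]
      linarith
    · have h1 : ¬ IsTet 𝒯 i k l j := fun h' => h h'.rotate.rotate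
      have h2 : ¬ IsTet 𝒯 i l j k := fun h' => h h'.rotate
      unfold IsTet at h h1 h2
      rw [if_neg h, if_neg h1, if_neg h2]
      norm_num
  rw [← sub_eq_zero, ← Finset.sum_sub_distrib]
  refine Eq.trans ?_ ((congrArg (1 / 2 * ·) hcyc).trans (mul_zero _))
  rw [Finset.mul_sum]
  refine Finset.sum_congr rfl fun j _ => ?_
  by_cases he : IsEdge 𝒯 i j
  · rw [if_pos he, if_pos he, (C.hasDerivAt_angSum hft hf i j).deriv, dualLen]
    have hsub : ∀ X Y c e w : ℝ,
        c * (1 / 2 * X) - 2 * (1 / 2 * Y) / e * w = 1 / 2 * (c * X - 2 / e * w * Y) := by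
      intro X Y c e w; ring
    rw [hsub]
    simp only [Finset.mul_sum, ← Finset.sum_sub_distrib, mul_ite, mul_zero]
    refine Finset.sum_congr rfl fun k _ => Finset.sum_congr rfl fun l _ => ?_
    split_ifs <;> ring
  · rw [if_neg he, if_neg he, sub_zero]
    have hn : ∀ k l, ¬ IsTet 𝒯 i j k l := fun k l h => he h.edge_left
    have h0 : ∀ k l (X : ℝ), (if ({i, j, k, l} : Finset V) ∈ 𝒯 ∧
      i ≠ j ∧ i ≠ k ∧ i ≠ l ∧ j ≠ k ∧ j ≠ l ∧ k ≠ l then X else 0) = 0 :=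
      fun k l X => if_neg (hn k l)
    simp only [h0, Finset.sum_const_zero, mul_zero]

end Curve

end Conformal3D

open Conformal3D in
/-- Under a conformal variation `f(t)` of a three-dimensional conformal
structure, at `t = 0`:
`(d/dt) K_i = −Σ_{j : {i,j} edge} (2ℓ*_ij/ℓ_ij − (q_ij/ℓ_ij) K_ij)(f_j′ − f_i′) + K_i f_i′`. -/
theorem scalar_curvature_variation_3d {V : Type*} [Fintype V] [DecidableEq V]
    {𝒯 : Finset (Finset V)} {U : Set (V → ℝ)} (C : Conformal3D V 𝒯 U)
    (ε : ℝ) (hε : 0 < ε) (f : ℝ → (V → ℝ))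
    (hmem : ∀ t ∈ Set.Ioo (-ε) ε, f t ∈ U)
    (hsmooth : ContDiffOn ℝ (⊤ : ℕ∞) f (Set.Ioo (-ε) ε)) (i : V) :
    HasDerivAt (fun t => C.Kv (f t) i)
      (-(∑ j : V,
          if IsEdge 𝒯 i j then
            (2 * C.dualLen (f 0) i j / C.len (f 0) i j
                - C.qq (f 0) i j / C.len (f 0) i j * C.Kedge (f 0) i j)
              * (deriv (fun t => f t j) 0 - deriv (fun t => f t i) 0)
          else 0)
        + C.Kv (f 0) i * deriv (fun t => f t i) 0) 0 := by
  have h0 : (0 : ℝ) ∈ Set.Ioo (-ε) ε := ⟨neg_lt_zero.2 hε, hε⟩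
  have hf : HasDerivAt f (deriv f 0) 0 :=
    ((hsmooth.contDiffAt (Ioo_mem_nhds h0.1 h0.2)).differentiableAt (by simp)).hasDerivAt
  have hv : ∀ j, deriv (fun t => f t j) 0 = deriv f 0 j :=
    fun j => (hasDerivAt_pi.1 hf j).deriv
  simp only [hv]
  generalize deriv f 0 = v at hf
  have hft := hmem 0 h0
  have hterm : ∀ j, HasDerivAt
      (fun t => if IsEdge 𝒯 i j then (2 * Real.pi - C.angSum (f t) i j) * C.d (f t) i j else 0)
      (if IsEdge 𝒯 i j then
        -deriv (fun s => C.angSum (f s) i j) 0 * C.d (f 0) i j +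
          (2 * Real.pi - C.angSum (f 0) i j) *
            (C.d (f 0) i j * v i + C.qq (f 0) i j * (v j - v i)) else 0) 0 := by
    intro j
    split_ifs with h
    · have hθ := (C.hasDerivAt_angSum hft hf i j).differentiableAt.hasDerivAt
      exact (hθ.const_sub _).mul (C.hasDerivAt_d hft hf h)
    · exact hasDerivAt_const _ _
  refine (HasDerivAt.fun_sum fun j _ => hterm j).congr_deriv ?_
  have hS := C.sum_d_mul_deriv_angSum hft hf i
  rw [Kv, Finset.sum_mul, ← sub_eq_zero, ← Finset.sum_neg_distrib, ← Finset.sum_add_distrib,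
    ← Finset.sum_sub_distrib]
  refine Eq.trans ?_ ((neg_eq_zero (a := _)).2 (sub_eq_zero.2 hS))
  rw [← Finset.sum_sub_distrib, ← Finset.sum_neg_distrib]
  refine Finset.sum_congr rfl fun j _ => ?_
  split_ifs with h
  · have hl : C.len (f 0) i j ≠ 0 := (C.lenPos _ hft i j h).ne'
    unfold Kedge
    field_simp
    ring
  · simp
end
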